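/- arXiv:2011.11845 — 2 statements merged into one kernel-verified Lean document; each statement's English description precedes it below -/
import Mathlib

section
/- Let ψ : [0,∞) → ℝ be a C^∞ function that is flat at the origin. Then the function defined by x ↦ ψ(x)/√x for x > 0 and by 0 at x = 0 is C^∞ on [0,∞) and flat at the origin. -/
open Set

/-- A function is *flat at the origin* (from the right) if all of its one-sided
iterated derivatives at `0`, taken within `[0,∞)`, vanish. -/
def FlatAtZeroOnIci (u : ℝ → ℝ) : Prop :=
  ∀ n : ℕ, iteratedDerivWithin n u (Set.Ici (0 : ℝ)) 0 = 0

open Filter Topology Asymptotics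

theorem FlatAtZeroOnIci.apply_zero {g : ℝ → ℝ} (hflat : FlatAtZeroOnIci g) : g 0 = 0 := by
  simpa using hflat 0

theorem FlatAtZeroOnIci.derivWithin {g : ℝ → ℝ} (hflat : FlatAtZeroOnIci g) :
    FlatAtZeroOnIci (derivWithin g (Ici 0)) := fun n => by
  rw [← iteratedDerivWithin_succ']
  exact hflat (n + 1)

theorem FlatAtZeroOnIci.isLittleO_pow {g : ℝ → ℝ} (hg : ContDiffOn ℝ (⊤ : ℕ∞) g (Ici 0))
    (hflat : FlatAtZeroOnIci g) (n : ℕ) : g =o[𝓝[Ici 0] 0] fun x => x ^ n := by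
  have h := taylor_isLittleO (convex_Ici (0 : ℝ)) self_mem_Ici
    (hg.of_le (show (n : WithTop ℕ∞) ≤ (⊤ : ℕ∞) by exact_mod_cast le_top))
  have h0 : ∀ x, taylorWithinEval g n (Ici 0) 0 x = 0 := fun x => by
    rw [taylor_within_apply]
    exact Finset.sum_eq_zero fun k _ => by rw [hflat k, smul_zero]
  simpa [h0] using h

theorem hasDerivWithinAt_rpow_mul {g : ℝ → ℝ} (hg : ContDiffOn ℝ (⊤ : ℕ∞) g (Ici 0))
    (hflat : FlatAtZeroOnIci g) (a : ℝ) {x : ℝ} (hx : x ∈ Ici (0 : ℝ)) :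
    HasDerivWithinAt (fun x => x ^ a * g x)
      (a * (x ^ (a - 1) * g x) + x ^ a * derivWithin g (Ici 0) x) (Ici 0) x := by
  rcases eq_or_lt_of_le (show 0 ≤ x from hx) with rfl | hpos
  · rw [hflat.apply_zero, show _root_.derivWithin g (Ici 0) 0 = 0 from hflat.derivWithin.apply_zero,
      hasDerivWithinAt_iff_isLittleO]
    simp only [hflat.apply_zero, mul_zero, sub_zero, add_zero, smul_zero]
    obtain ⟨n, hn⟩ := exists_nat_ge (max 1 (1 - a))
    have hn0 : n ≠ 0 := by
      rintro rfl
      have := (le_max_left _ _).trans hn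
      norm_num at this
    have hna := (le_max_right _ _).trans hn
    have hO : (fun x : ℝ => x ^ a * x ^ n) =O[𝓝[Ici 0] 0] fun x => x := by
      refine IsBigO.of_bound 1 ?_
      filter_upwards [self_mem_nhdsWithin,
        mem_nhdsWithin_of_mem_nhds (Iio_mem_nhds (zero_lt_one' ℝ))] with x hx0 hx1
      rcases eq_or_lt_of_le (show 0 ≤ x from hx0) with rfl | hpos
      · simp [hn0]
      · rw [← Real.rpow_natCast, ← Real.rpow_add hpos, one_mul,
          Real.norm_of_nonneg (Real.rpow_nonneg hpos.le _), Real.norm_of_nonneg hpos.le]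
        simpa using Real.rpow_le_rpow_of_exponent_ge hpos (le_of_lt hx1)
          (show 1 ≤ a + n by linarith)
    exact ((isBigO_refl (fun x : ℝ => x ^ a) _).mul_isLittleO
      (hflat.isLittleO_pow hg n)).trans_isBigO hO
  · have hd := (hg.differentiableOn (by simp) x hx).hasDerivWithinAt
    refine ((Real.hasDerivAt_rpow_const (p := a) (Or.inl hpos.ne')).hasDerivWithinAt.mul
      hd).congr_deriv ?_
    ring

theorem contDiffOn_rpow_mul_of_flat (n : ℕ) {g : ℝ → ℝ}
    (hg : ContDiffOn ℝ (⊤ : ℕ∞) g (Ici 0)) (hflat : FlatAtZeroOnIci g) (a : ℝ) :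
    ContDiffOn ℝ n (fun x => x ^ a * g x) (Ici 0) ∧
      iteratedDerivWithin n (fun x => x ^ a * g x) (Ici 0) 0 = 0 := by
  induction n generalizing g a with
  | zero =>
    refine ⟨contDiffOn_zero.2 fun x hx =>
      (hasDerivWithinAt_rpow_mul hg hflat a hx).continuousWithinAt, ?_⟩
    simp [hflat.apply_zero]
  | succ n ih =>
    have hderiv : EqOn (derivWithin (fun x => x ^ a * g x) (Ici 0))
        ((fun x => a * (x ^ (a - 1) * g x)) + fun x => x ^ a * derivWithin g (Ici 0) x)
        (Ici 0) := fun x hx =>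
      (hasDerivWithinAt_rpow_mul hg hflat a hx).derivWithin (uniqueDiffOn_Ici 0 x hx)
    obtain ⟨h₁, h₁'⟩ := ih hg hflat (a - 1)
    obtain ⟨h₂, h₂'⟩ := ih (hg.derivWithin (uniqueDiffOn_Ici 0) (by simp)) hflat.derivWithin a
    have h₃ : ContDiffOn ℝ n (fun x => a * (x ^ (a - 1) * g x)) (Ici 0) :=
      contDiffOn_const.mul h₁
    constructor
    · push_cast
      rw [contDiffOn_succ_iff_derivWithin (uniqueDiffOn_Ici 0)]
      exact ⟨fun x hx => (hasDerivWithinAt_rpow_mul hg hflat a hx).differentiableWithinAt,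
        by simp, (h₃.add h₂).congr hderiv⟩
    · rw [iteratedDerivWithin_succ', iteratedDerivWithin_congr hderiv self_mem_Ici,
        iteratedDerivWithin_add self_mem_Ici (uniqueDiffOn_Ici 0) (h₃ 0 self_mem_Ici)
          (h₂ 0 self_mem_Ici), h₂',
        iteratedDerivWithin_const_mul self_mem_Ici (uniqueDiffOn_Ici 0) a (h₁ 0 self_mem_Ici),
        h₁', mul_zero, add_zero]

theorem flat_div_sqrt_smooth_flat (ψ : ℝ → ℝ)
    (hψ : ContDiffOn ℝ (⊤ : ℕ∞) ψ (Set.Ici 0))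
    (hflat : FlatAtZeroOnIci ψ) :
    ContDiffOn ℝ (⊤ : ℕ∞) (fun x => if x = 0 then 0 else ψ x / Real.sqrt x) (Set.Ici 0) ∧
      FlatAtZeroOnIci (fun x => if x = 0 then 0 else ψ x / Real.sqrt x) := by
  have heq : EqOn (fun x => if x = 0 then 0 else ψ x / Real.sqrt x)
      (fun x => x ^ (-(1 / 2) : ℝ) * ψ x) (Ici 0) := fun x hx => by
    rcases eq_or_ne x 0 with rfl | h0
    · simp [hflat.apply_zero]
    · simp only [h0, if_false]
      rw [Real.rpow_neg hx, Real.sqrt_eq_rpow, div_eq_inv_mul]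
  refine ⟨contDiffOn_infty.2 fun n => (contDiffOn_rpow_mul_of_flat n hψ hflat _).1.congr heq,
    fun n => ?_⟩
  rw [iteratedDerivWithin_congr heq self_mem_Ici]
  exact (contDiffOn_rpow_mul_of_flat n hψ hflat _).2
end

section
/- Let ψ : ℝ → ℝ be a C^∞ function that is flat at the origin. Define g : ℝ → ℝ by g(x) = −√(−x) · ψ(x) for x ≤ 0 and g(x) = 0 for x > 0. Then g is a C^∞ function on ℝ and is flat at the origin. -/
/-- A function `u : ℝ → ℝ` is *flat at the origin* if all of its iterated
derivatives at `0` vanish (in particular its value, the `0`-th derivative). -/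
def FlatAtZero (u : ℝ → ℝ) : Prop :=
  ∀ n : ℕ, iteratedDeriv n u 0 = 0

open Filter Topology Asymptotics

theorem FlatAtZero.deriv {u : ℝ → ℝ} (hu : FlatAtZero u) : FlatAtZero (deriv u) := fun n => by
  rw [← iteratedDeriv_succ']
  exact hu (n + 1)

theorem FlatAtZero.isLittleO_pow {u : ℝ → ℝ} (hflat : FlatAtZero u)
    (hu : ContDiff ℝ (⊤ : ℕ∞) u) (n : ℕ) : u =o[𝓝 0] fun x => x ^ n := by
  have h := taylor_isLittleO_univ (f := u) (x₀ := 0) (n := n)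
    (hu.of_le (by exact_mod_cast le_top))
  have h0 (x : ℝ) : taylorWithinEval u n Set.univ 0 x = 0 := by
    simp [taylor_within_apply, iteratedDerivWithin_univ, hflat _]
  simpa [h0] using h

/-- The function `√(-x) * x⁻ᵏ * u x`, which vanishes for `x ≥ 0`. -/
noncomputable def sqrtNegMul (k : ℕ) (u : ℝ → ℝ) (x : ℝ) : ℝ :=
  √(-x) * x⁻¹ ^ k * u x

theorem sqrtNegMul_of_nonneg (k : ℕ) (u : ℝ → ℝ) {x : ℝ} (hx : 0 ≤ x) :
    sqrtNegMul k u x = 0 := by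
  simp [sqrtNegMul, Real.sqrt_eq_zero_of_nonpos (neg_nonpos.2 hx)]

theorem hasDerivAt_sqrtNegMul_zero (k : ℕ) {u : ℝ → ℝ} (hflat : FlatAtZero u)
    (hu : ContDiff ℝ (⊤ : ℕ∞) u) : HasDerivAt (sqrtNegMul k u) 0 0 := by
  rw [hasDerivAt_iff_isLittleO]
  have hs : (fun x : ℝ => √(-x)) =O[𝓝 0] fun _ => (1 : ℝ) :=
    (by fun_prop : Continuous fun x : ℝ => √(-x)).continuousAt.isBigO_one ℝ
  have hp := hs.mul_isLittleO
    ((isBigO_refl (fun x : ℝ => x⁻¹ ^ k) (𝓝 0)).mul_isLittleO (hflat.isLittleO_pow hu (k + 1)))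
  have hb : (fun x : ℝ => 1 * (x⁻¹ ^ k * x ^ (k + 1))) = fun x => x := by
    ext x
    rcases eq_or_ne x 0 with rfl | hx
    · simp
    · rw [one_mul, pow_succ, ← mul_assoc, ← mul_pow, inv_mul_cancel₀ hx, one_pow, one_mul]
  rw [hb] at hp
  simpa [sqrtNegMul, mul_assoc] using hp

theorem hasDerivAt_sqrtNegMul (k : ℕ) {u : ℝ → ℝ} (hflat : FlatAtZero u)
    (hu : ContDiff ℝ (⊤ : ℕ∞) u) (x : ℝ) :
    HasDerivAt (sqrtNegMul k u)
      (sqrtNegMul k (deriv u) x + (1 / 2 - k) * sqrtNegMul (k + 1) u x) x := by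
  rcases lt_trichotomy x 0 with hx | rfl | hx
  · have hs : √(-x) ^ 2 = -x := Real.sq_sqrt (by linarith)
    have hs0 : √(-x) ≠ 0 := (Real.sqrt_pos.2 (neg_pos.2 hx)).ne'
    have hx0 : x ≠ 0 := hx.ne
    have h1 : HasDerivAt (fun y : ℝ => √(-y)) (√(-x) * x⁻¹ / 2) x := by
      refine ((hasDerivAt_neg x).sqrt (neg_pos.2 hx).ne').congr_deriv ?_
      field_simp
      linarith
    have h2 : HasDerivAt (fun y : ℝ => y⁻¹ ^ k) (-k * x⁻¹ ^ (k + 1)) x := by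
      refine ((hasDerivAt_inv hx0).pow k).congr_deriv ?_
      cases k with
      | zero => simp
      | succ k =>
        rw [Nat.add_sub_cancel, ← inv_pow]
        ring
    have h3 : HasDerivAt u (deriv u x) x :=
      (hu.differentiable (by simp)).differentiableAt.hasDerivAt
    refine ((h1.mul h2).mul h3).congr_deriv ?_
    simp only [sqrtNegMul, Pi.mul_apply]
    ring
  · simpa [sqrtNegMul] using hasDerivAt_sqrtNegMul_zero k hflat hu
  · rw [sqrtNegMul_of_nonneg _ _ hx.le, sqrtNegMul_of_nonneg _ _ hx.le, mul_zero, add_zero]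
    refine (hasDerivAt_const x (0 : ℝ)).congr_of_eventuallyEq ?_
    filter_upwards [lt_mem_nhds hx] with y hy
    exact sqrtNegMul_of_nonneg _ _ hy.le

theorem contDiff_sqrtNegMul (k : ℕ) {u : ℝ → ℝ} (hflat : FlatAtZero u)
    (hu : ContDiff ℝ (⊤ : ℕ∞) u) : ContDiff ℝ (⊤ : ℕ∞) (sqrtNegMul k u) := by
  refine contDiff_infty.2 fun n => ?_
  induction n generalizing k u with
  | zero =>
    exact contDiff_zero.2 (continuous_iff_continuousAt.2 fun x =>
      (hasDerivAt_sqrtNegMul k hflat hu x).continuousAt)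
  | succ n ih =>
    have hd : deriv (sqrtNegMul k u) =
        fun x => sqrtNegMul k (deriv u) x + (1 / 2 - k) * sqrtNegMul (k + 1) u x :=
      funext fun x => (hasDerivAt_sqrtNegMul k hflat hu x).deriv
    push_cast
    refine contDiff_succ_iff_deriv.2
      ⟨fun x => (hasDerivAt_sqrtNegMul k hflat hu x).differentiableAt, by simp, ?_⟩
    rw [hd]
    exact (ih k hflat.deriv (contDiff_infty_iff_deriv.1 hu).2).add
      (contDiff_const.mul (ih (k + 1) hflat hu))

/-- A smooth function vanishing on the positive half-line is flat at the origin. -/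
theorem flatAtZero_of_eq_zero_of_pos {u : ℝ → ℝ} (hu : ContDiff ℝ (⊤ : ℕ∞) u)
    (h : ∀ x, 0 < x → u x = 0) : FlatAtZero u := fun n => by
  have hc : Continuous (iteratedDeriv n u) :=
    hu.continuous_iteratedDeriv n (by exact_mod_cast le_top)
  have hz : ∀ᶠ x in 𝓝[>] (0 : ℝ), iteratedDeriv n u x = 0 := by
    filter_upwards [self_mem_nhdsWithin] with x hx
    have he : u =ᶠ[𝓝 x] fun _ => 0 := by
      filter_upwards [lt_mem_nhds hx] with y hy
      exact h y hy
    simp [he.iteratedDeriv_eq n]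
  exact tendsto_nhds_unique (hc.continuousAt.mono_left nhdsWithin_le_nhds)
    (tendsto_const_nhds.congr' (hz.mono fun _ hx => hx.symm))

theorem neg_sqrt_mul_flat_smooth (ψ : ℝ → ℝ)
    (hψ : ContDiff ℝ (⊤ : ℕ∞) ψ) (hflat : FlatAtZero ψ) :
    ContDiff ℝ (⊤ : ℕ∞) (fun x => if x ≤ 0 then -Real.sqrt (-x) * ψ x else 0) ∧
      FlatAtZero (fun x => if x ≤ 0 then -Real.sqrt (-x) * ψ x else 0) := by
  have hsmooth : ContDiff ℝ (⊤ : ℕ∞)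
      (fun x => if x ≤ 0 then -Real.sqrt (-x) * ψ x else 0) := by
    convert (contDiff_sqrtNegMul 0 hflat hψ).neg using 2 with x
    split_ifs with hx
    · simp [sqrtNegMul]
    · simp [sqrtNegMul_of_nonneg 0 ψ (not_le.1 hx).le]
  exact ⟨hsmooth, flatAtZero_of_eq_zero_of_pos hsmooth fun x hx => if_neg hx.not_ge⟩
end
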